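/- arXiv:1002.3448 — 2 statements merged into one kernel-verified Lean document; each statement's English description precedes it below -/
import Mathlib

section
/- For any probability distribution Q on ℝ^d, the following three properties are equivalent: (a) csupp(Q) has nonempty interior; (b) Q(H) < 1 for every hyperplane H ⊂ ℝ^d; (c) lim_{δ ↓ 0} sup{ Q(C) : C ⊂ ℝ^d closed and convex with Leb(C) ≤ δ } < 1, where Leb denotes Lebesgue measure on ℝ^d. -/
open MeasureTheory Filter Topology Set
open scoped ENNReal RealInnerProductSpace BoundedContinuousFunction

noncomputable section

/-- Truncation of an extended real number to `ℝ≥0∞`. -/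
def EReal.toENN (x : EReal) : ℝ≥0∞ := if x = ⊤ then ⊤ else ENNReal.ofReal x.toReal

/-- The real-valued exponential of an extended real number (`⊤` is sent to `0`,
but this value is never used for functions in the class `Φ`). -/
def EReal.expR (x : EReal) : ℝ := (EReal.exp x).toReal

/-- The class `Φ(d)`: upper semicontinuous, concave functions `φ : E → [-∞, ∞)`
which are coercive in the sense that `φ x → -∞` as `‖x‖ → ∞`. -/
def IsPhi {E : Type*} [NormedAddCommGroup E] [NormedSpace ℝ E] (φ : E → EReal) : Prop :=
  UpperSemicontinuous φ ∧ (∀ x, φ x ≠ ⊤) ∧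
  (∀ x y : E, ∀ a b : ℝ, 0 < a → 0 < b → a + b = 1 →
    (a : EReal) * φ x + (b : EReal) * φ y ≤ φ (a • x + b • y)) ∧
  Tendsto φ (Filter.comap (fun x : E => ‖x‖) atTop) (𝓝 ⊥)

/-- The integral of an `EReal`-valued function with respect to a measure,
defined as the difference of the integrals of the positive and negative parts. -/
def eint {E : Type*} [MeasurableSpace E] (Q : Measure E) (φ : E → EReal) : EReal :=
  ((∫⁻ x, (φ x).toENN ∂Q : ℝ≥0∞) : EReal) - ((∫⁻ x, (-(φ x)).toENN ∂Q : ℝ≥0∞) : EReal)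

/-- The log-likelihood-type functional `L(φ, Q) = ∫ φ dQ - ∫ e^{φ(x)} dx + 1`. -/
def Lfun {E : Type*} [NormedAddCommGroup E] [NormedSpace ℝ E] [MeasureSpace E]
    (φ : E → EReal) (Q : Measure E) : EReal :=
  eint Q φ - ((∫⁻ x, EReal.exp (φ x) : ℝ≥0∞) : EReal) + 1

/-- The profile log-likelihood `L(Q) = sup_{φ ∈ Φ} L(φ, Q)`. -/
def Lprof {E : Type*} [NormedAddCommGroup E] [NormedSpace ℝ E] [MeasureSpace E]
    (Q : Measure E) : EReal :=
  ⨆ φ ∈ {φ : E → EReal | IsPhi φ}, Lfun φ Q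

/-- The convex support of a measure: the intersection of all closed convex sets of full
measure. -/
def csupp {E : Type*} [NormedAddCommGroup E] [NormedSpace ℝ E] [MeasurableSpace E]
    (Q : Measure E) : Set E :=
  ⋂₀ {C : Set E | IsClosed C ∧ Convex ℝ C ∧ Q C = 1}

/-- `ψ` is the (a) maximizer of `L(·, Q)` over `Φ`, i.e. `ψ = ψ(·|Q)`. -/
def IsMLE {E : Type*} [NormedAddCommGroup E] [NormedSpace ℝ E] [MeasureSpace E]
    (Q : Measure E) (ψ : E → EReal) : Prop :=
  IsPhi ψ ∧ ∀ φ : E → EReal, IsPhi φ → Lfun φ Q ≤ Lfun ψ Q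

/-- Weak convergence of a sequence of measures. -/
def WConv {E : Type*} [NormedAddCommGroup E] [MeasurableSpace E]
    (Qn : ℕ → Measure E) (Q : Measure E) : Prop :=
  ∀ g : E →ᵇ ℝ, Tendsto (fun n => ∫ x, g x ∂(Qn n)) atTop (𝓝 (∫ x, g x ∂Q))

/-- The Mallows (Wasserstein-1, Kantorovich–Rubinstein) distance. -/
def D1 {E : Type*} [NormedAddCommGroup E] [MeasurableSpace E] (Q Q' : Measure E) : ℝ :=
  sSup {r : ℝ | ∃ h : E → ℝ, LipschitzWith 1 h ∧ r = |(∫ x, h x ∂Q) - ∫ x, h x ∂Q'|}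

/-- The bounded Lipschitz distance. -/
def DBL (Q Q' : Measure ℝ) : ℝ :=
  sSup {r : ℝ | ∃ h : ℝ → ℝ, (∀ x, |h x| ≤ 1) ∧ LipschitzWith 1 h ∧
    r = |(∫ x, h x ∂Q) - ∫ x, h x ∂Q'|}

/-- The Kolmogorov–Smirnov distance. -/
def DKS (Q Q' : Measure ℝ) : ℝ :=
  ⨆ t : ℝ, |(Q' (Set.Iic t)).toReal - (Q (Set.Iic t)).toReal|

/-- Convolution of two measures. -/
def mconv {E : Type*} [NormedAddCommGroup E] [MeasurableSpace E] (Q R : Measure E) : Measure E :=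
  (Q.prod R).map (fun p => p.1 + p.2)

/-- The empirical measure of a finite tuple of real numbers. -/
def empQ {n : ℕ} (v : Fin n → ℝ) : Measure ℝ :=
  ((n : ℝ≥0∞))⁻¹ • ∑ i, Measure.dirac (v i)

end


lemma aux_hyperplane {d : ℕ} (S : Set (EuclideanSpace ℝ (Fin d))) (hS : S.Nonempty)
    (h : affineSpan ℝ S ≠ ⊤) :
    ∃ (u : EuclideanSpace ℝ (Fin d)) (r : ℝ), u ≠ 0 ∧ S ⊆ {x | ⟪u, x⟫ = r} := by
  obtain ⟨p, hp⟩ := hS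
  have hne : (affineSpan ℝ S).direction ≠ ⊤ := by
    intro h'
    exact h ((AffineSubspace.direction_eq_top_iff_of_nonempty
      ⟨p, subset_affineSpan ℝ S hp⟩).1 h')
  have h2 : (affineSpan ℝ S).directionᗮ ≠ ⊥ := by
    intro h'
    exact hne ((Submodule.orthogonal_eq_bot_iff).1 h')
  obtain ⟨u, hu, hu0⟩ := (Submodule.ne_bot_iff _).1 h2
  refine ⟨u, ⟪u, p⟫, hu0, fun x hx => ?_⟩
  have h3 : x - p ∈ (affineSpan ℝ S).direction :=
    AffineSubspace.vsub_mem_direction (subset_affineSpan ℝ S hx) (subset_affineSpan ℝ S hp)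
  have h4 := (Submodule.mem_orthogonal' _ _).1 hu _ h3
  rw [inner_sub_right] at h4
  simp only [mem_ofPred_eq]
  linarith

lemma aux_support_sub {d : ℕ} (Q : Measure (EuclideanSpace ℝ (Fin d))) [IsProbabilityMeasure Q]
    (C : Set (EuclideanSpace ℝ (Fin d))) (hC : IsClosed C) (h : Q C = 1) : Q.support ⊆ C := by
  apply Measure.support_subset_of_isClosed hC
  rw [mem_ae_iff]
  exact (prob_compl_eq_zero_iff hC.measurableSet).2 h

lemma aux_one_of_support {d : ℕ} (Q : Measure (EuclideanSpace ℝ (Fin d)))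
    [IsProbabilityMeasure Q]
    (C : Set (EuclideanSpace ℝ (Fin d))) (h : Q.support ⊆ C) : Q C = 1 := by
  have h1 : Q C = Q univ := by
    apply measure_congr
    rw [eventuallyEq_univ]
    exact mem_of_superset Measure.support_mem_ae h
  rw [h1, measure_univ]

lemma aux_ball {d : ℕ} (T C : Set (EuclideanSpace ℝ (Fin d))) (z : EuclideanSpace ℝ (Fin d))
    (ε : ℝ) (hε : 0 < ε) (hz : Metric.ball z (2 * ε) ⊆ convexHull ℝ T)
    (hC : IsClosed C) (hc : Convex ℝ C) (hT : ∀ x ∈ T, (C ∩ Metric.ball x ε).Nonempty) :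
    Metric.ball z ε ⊆ C := by
  intro w hw
  by_contra hwC
  obtain ⟨f, s, hf, hs⟩ := geometric_hahn_banach_closed_point hc hC hwC
  obtain ⟨u, rfl⟩ := (InnerProductSpace.toDual ℝ (EuclideanSpace ℝ (Fin d))).surjective f
  simp only [InnerProductSpace.toDual_apply_apply] at hf hs
  have hle : convexHull ℝ T ⊆ {x | ⟪u, x⟫ ≤ s + ‖u‖ * ε} := by
    apply convexHull_min
    · intro x hx
      obtain ⟨y, hy, hyx⟩ := hT x hx
      have h1 := hf y hy
      have h2 : ⟪u, x - y⟫ ≤ ‖u‖ * ‖x - y‖ := real_inner_le_norm _ _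
      have h3 : ‖x - y‖ ≤ ε := by
        rw [Metric.mem_ball, dist_eq_norm] at hyx
        rw [norm_sub_rev]; exact hyx.le
      have h4 := mul_le_mul_of_nonneg_left h3 (norm_nonneg u)
      rw [inner_sub_right] at h2
      simp only [mem_ofPred_eq]
      linarith
    · exact convex_halfSpace_le (f := fun x => ⟪u, x⟫)
        ⟨fun x y => inner_add_right _ _ _, fun c x => inner_smul_right _ _ _⟩ _
  by_cases hu : u = 0
  · subst hu
    have hz' : z ∈ convexHull ℝ T := hz (Metric.mem_ball_self (by positivity))
    have hTn : T.Nonempty := convexHull_nonempty_iff.1 ⟨z, hz'⟩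
    obtain ⟨x, hx⟩ := hTn
    obtain ⟨y, hy, -⟩ := hT x hx
    have := hf y hy
    simp at this hs
    linarith
  have hun : 0 < ‖u‖ := norm_pos_iff.2 hu
  have hmem : w + (ε / ‖u‖) • u ∈ Metric.ball z (2 * ε) := by
    rw [Metric.mem_ball, dist_eq_norm] at *
    calc ‖w + (ε / ‖u‖) • u - z‖ = ‖(w - z) + (ε / ‖u‖) • u‖ := by congr 1; abel
      _ ≤ ‖w - z‖ + ‖(ε / ‖u‖) • u‖ := norm_add_le _ _
      _ = ‖w - z‖ + ε := by
        rw [norm_smul, Real.norm_of_nonneg (by positivity), div_mul_cancel₀ _ hun.ne']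
      _ < 2 * ε := by linarith
  have h5 := hle (hz hmem)
  simp only [mem_ofPred_eq, inner_add_right, inner_smul_right, real_inner_self_eq_norm_sq] at h5
  have h6 : ε / ‖u‖ * ‖u‖ ^ 2 = ‖u‖ * ε := by field_simp
  linarith

lemma aux_hyp_closed {d : ℕ} (u : EuclideanSpace ℝ (Fin d)) (r : ℝ) :
    IsClosed {x | ⟪u, x⟫ = r} :=
  isClosed_eq (by fun_prop) continuous_const

lemma aux_hyp_convex {d : ℕ} (u : EuclideanSpace ℝ (Fin d)) (r : ℝ) :
    Convex ℝ {x | ⟪u, x⟫ = r} :=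
  convex_hyperplane (f := fun x => ⟪u, x⟫)
    ⟨fun x y => inner_add_right _ _ _, fun c x => inner_smul_right _ _ _⟩ _

lemma aux_hyp_interior {d : ℕ} (u : EuclideanSpace ℝ (Fin d)) (r : ℝ) (hu : u ≠ 0) :
    ¬ (interior {x | ⟪u, x⟫ = r}).Nonempty := by
  rintro ⟨z, hz⟩
  obtain ⟨ε, hε, hb⟩ := Metric.isOpen_iff.1 isOpen_interior z hz
  have hun : 0 < ‖u‖ := norm_pos_iff.2 hu
  have h1 : ⟪u, z⟫ = r := by
    have := interior_subset hz
    exact this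
  have h2 : z + (ε / 2 / ‖u‖) • u ∈ Metric.ball z ε := by
    rw [Metric.mem_ball, dist_eq_norm, add_sub_cancel_left, norm_smul,
      Real.norm_of_nonneg (by positivity), div_mul_cancel₀ _ hun.ne']
    linarith
  have h3 : ⟪u, z + (ε / 2 / ‖u‖) • u⟫ = r := by
    have := interior_subset (hb h2)
    exact this
  rw [inner_add_right, inner_smul_right, real_inner_self_eq_norm_sq] at h3
  have : 0 < ε / 2 / ‖u‖ * ‖u‖ ^ 2 := by positivity
  linarith

lemma aux_hyp_volume {d : ℕ} (u : EuclideanSpace ℝ (Fin d)) (r : ℝ) (hu : u ≠ 0) :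
    volume {x | ⟪u, x⟫ = r} = 0 := by
  have h := (aux_hyp_convex u r).addHaar_frontier (volume)
  have h0 : interior {x | ⟪u, x⟫ = r} = ∅ :=
    not_nonempty_iff_eq_empty.1 (aux_hyp_interior u r hu)
  rwa [frontier, h0, sdiff_empty, (aux_hyp_closed u r).closure_eq] at h

lemma aux_c {d : ℕ} (Q : Measure (EuclideanSpace ℝ (Fin d))) [IsProbabilityMeasure Q]
    (h : affineSpan ℝ Q.support = ⊤) :
    (⨅ δ ∈ Set.Ioi (0 : ℝ),
        ⨆ C ∈ {C : Set (EuclideanSpace ℝ (Fin d)) |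
          IsClosed C ∧ Convex ℝ C ∧ volume C ≤ ENNReal.ofReal δ}, Q C) < 1 := by
  obtain ⟨T, hTS, hTspan, hTi⟩ := exists_affineIndependent ℝ (EuclideanSpace ℝ (Fin d)) Q.support
  have hTfin : T.Finite := finite_set_of_fin_dim_affineIndependent ℝ hTi
  rw [h] at hTspan
  obtain ⟨z, hz⟩ := interior_convexHull_nonempty_iff_affineSpan_eq_top.2 hTspan
  obtain ⟨ε', hε', hb⟩ := Metric.isOpen_iff.1 isOpen_interior z hz
  obtain ⟨ε, hε, rfl⟩ : ∃ ε, 0 < ε ∧ ε' = 2 * ε := ⟨ε' / 2, by positivity, by ring⟩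
  have hpos : ∀ x ∈ T, 0 < Q (Metric.ball x ε) := fun x hx =>
    (Measure.mem_support_iff_forall x).1 (hTS hx) _ (Metric.ball_mem_nhds x hε)
  have hTn : T.Nonempty := convexHull_nonempty_iff.1 ⟨z, interior_subset hz⟩
  obtain ⟨x₀, hx₀, hmin⟩ := hTfin.exists_minimalFor (fun x => Q (Metric.ball x ε)) T hTn
  have hmin : ∀ x ∈ T, Q (Metric.ball x₀ ε) ≤ Q (Metric.ball x ε) := by
    intro x hx
    rcases le_total (Q (Metric.ball x₀ ε)) (Q (Metric.ball x ε)) with h | h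
    · exact h
    · exact hmin hx h
  set V := volume (Metric.ball z ε) with hV
  have hV0 : 0 < V := Metric.measure_ball_pos _ _ hε
  have hVt : V ≠ ⊤ := measure_ball_lt_top.ne
  have hVr : 0 < V.toReal := ENNReal.toReal_pos hV0.ne' hVt
  have hlt : 1 - Q (Metric.ball x₀ ε) < 1 :=
    ENNReal.sub_lt_self ENNReal.one_ne_top one_ne_zero (hpos x₀ hx₀).ne'
  refine lt_of_le_of_lt (iInf₂_le (V.toReal / 2) (mem_Ioi.2 (by positivity))) ?_
  refine lt_of_le_of_lt (iSup₂_le ?_) hlt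
  rintro C ⟨hC, hc, hvol⟩
  by_contra hcon
  rw [not_le] at hcon
  have hsub : Metric.ball z ε ⊆ C := by
    refine aux_ball T C z ε hε (hb.trans interior_subset) hC hc fun x hx => ?_
    by_contra hne
    have hdis : Metric.ball x ε ⊆ Cᶜ := fun y hy hyC => hne ⟨y, hyC, hy⟩
    have h1 : Q (Metric.ball x₀ ε) ≤ 1 - Q C := by
      rw [← prob_compl_eq_one_sub hC.measurableSet]
      exact (hmin x hx).trans (measure_mono hdis)
    have h2 : Q C ≤ 1 - Q (Metric.ball x₀ ε) := by
      rw [ENNReal.le_sub_iff_add_le_right] at *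
      · rwa [add_comm]
      all_goals first | exact measure_ne_top _ _ | exact prob_le_one
    exact absurd hcon (not_lt.2 h2)
  have h3 : V ≤ ENNReal.ofReal (V.toReal / 2) := (measure_mono hsub).trans hvol
  have h4 := ENNReal.toReal_mono ENNReal.ofReal_ne_top h3
  rw [ENNReal.toReal_ofReal (by positivity)] at h4
  linarith

/-- **Lemma 1 (second part).** For a probability distribution `Q` on `ℝ^d`, the following are
equivalent: (a) `csupp Q` has nonempty interior; (b) `Q(H) < 1` for every hyperplane `H`;
(c) the limit as `δ ↓ 0` (= the infimum over `δ > 0`, by monotonicity) of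
`sup { Q(C) : C closed convex, Leb(C) ≤ δ }` is `< 1`. -/
theorem csupp_interior_nonempty_tfae {d : ℕ}
    (Q : Measure (EuclideanSpace ℝ (Fin d))) [IsProbabilityMeasure Q] :
    ((interior (csupp Q)).Nonempty ↔
      ∀ (u : EuclideanSpace ℝ (Fin d)) (r : ℝ), u ≠ 0 → Q {x | ⟪u, x⟫ = r} < 1) ∧
    ((interior (csupp Q)).Nonempty ↔
      (⨅ δ ∈ Set.Ioi (0 : ℝ),
        ⨆ C ∈ {C : Set (EuclideanSpace ℝ (Fin d)) |
          IsClosed C ∧ Convex ℝ C ∧ volume C ≤ ENNReal.ofReal δ}, Q C) < 1) := by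
  have hspan_of_b : (∀ (u : EuclideanSpace ℝ (Fin d)) (r : ℝ), u ≠ 0 →
      Q {x | ⟪u, x⟫ = r} < 1) → affineSpan ℝ Q.support = ⊤ := by
    intro hb
    by_contra hne
    have hn : Q.support.Nonempty := by
      by_contra h0
      rw [not_nonempty_iff_eq_empty] at h0
      have := aux_one_of_support Q ∅ h0.le
      simp at this
    obtain ⟨u, r, hu, hs⟩ := aux_hyperplane _ hn hne
    exact (hb u r hu).ne (aux_one_of_support Q _ hs)
  have hab : (interior (csupp Q)).Nonempty →
      ∀ (u : EuclideanSpace ℝ (Fin d)) (r : ℝ), u ≠ 0 → Q {x | ⟪u, x⟫ = r} < 1 := by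
    intro ha u r hu
    refine lt_of_le_of_ne prob_le_one fun h1 => ?_
    have hsub : csupp Q ⊆ {x | ⟪u, x⟫ = r} :=
      sInter_subset_of_mem (show _ ∧ _ ∧ _ from ⟨aux_hyp_closed u r, aux_hyp_convex u r, h1⟩)
    exact aux_hyp_interior u r hu (ha.mono (interior_mono hsub))
  have hba : (∀ (u : EuclideanSpace ℝ (Fin d)) (r : ℝ), u ≠ 0 →
      Q {x | ⟪u, x⟫ = r} < 1) → (interior (csupp Q)).Nonempty := by
    intro hb
    refine (interior_convexHull_nonempty_iff_affineSpan_eq_top.2 (hspan_of_b hb)).mono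
      (interior_mono ?_)
    refine subset_sInter ?_
    rintro C ⟨hC, hc, h1⟩
    exact convexHull_min (aux_support_sub Q C hC h1) hc
  refine ⟨⟨hab, hba⟩, fun ha => aux_c Q (hspan_of_b (hab ha)), fun hc => hba ?_⟩
  intro u r hu
  refine lt_of_le_of_lt ?_ hc
  refine le_iInf₂ fun δ _ => ?_
  refine le_iSup₂_of_le {x | ⟪u, x⟫ = r}
    ⟨aux_hyp_closed u r, aux_hyp_convex u r, ?_⟩ le_rfl
  rw [aux_hyp_volume u r hu]
  exact zero_le
end

section
/- For any probability distribution Q on ℝ^d, the profile log-likelihood L(Q) is a real number (i.e. finite) if and only if ∫ ‖x‖ Q(dx) < ∞ and the interior of csupp(Q) is nonempty. Moreover, L(Q) = −∞ when ∫ ‖x‖ Q(dx) = ∞, and L(Q) = +∞ when ∫ ‖x‖ Q(dx) < ∞ but the interior of csupp(Q) is empty. -/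
open MeasureTheory Filter Topology Set
open scoped ENNReal RealInnerProductSpace BoundedContinuousFunction

lemma ph_conc {E : Type*} [NormedAddCommGroup E] [NormedSpace ℝ E] {φ : E → EReal} (h : IsPhi φ)
    {x y : E} {s t a b : ℝ} (ha : 0 < a) (hb : 0 < b) (hab : a + b = 1)
    (hs : (s : EReal) ≤ φ x) (ht : (t : EReal) ≤ φ y) :
    ((a * s + b * t : ℝ) : EReal) ≤ φ (a • x + b • y) := by
  obtain ⟨_, h2, h3, _⟩ := h
  refine le_trans ?_ (h3 x y a b ha hb hab)
  have hx1 := h2 x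
  have hy1 := h2 y
  generalize φ x = p at *
  generalize φ y = q at *
  have hp : p ≠ ⊥ := by rintro rfl; simp at hs
  have hq : q ≠ ⊥ := by rintro rfl; simp at ht
  lift p to ℝ using ⟨hx1, hp⟩
  lift q to ℝ using ⟨hy1, hq⟩
  norm_cast at *
  gcongr

lemma ph_convex {E : Type*} [NormedAddCommGroup E] [NormedSpace ℝ E] {φ : E → EReal} (h : IsPhi φ)
    (t : ℝ) : Convex ℝ {x | (t : EReal) ≤ φ x} := by
  rw [convex_iff_forall_pos]
  intro x hx y hy a b ha hb hab
  have := ph_conc h ha hb hab hx hy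
  rw [← add_mul, hab, one_mul] at this
  exact this

lemma ph_closed {E : Type*} [NormedAddCommGroup E] [NormedSpace ℝ E] {φ : E → EReal} (h : IsPhi φ)
    (t : ℝ) : IsClosed {x | (t : EReal) ≤ φ x} := h.1.isClosed_preimage _

lemma ph_coer {E : Type*} [NormedAddCommGroup E] [NormedSpace ℝ E] {φ : E → EReal} (h : IsPhi φ)
    (c : ℝ) : ∃ R : ℝ, ∀ x, R ≤ ‖x‖ → φ x < c := by
  have := (EReal.tendsto_nhds_bot_iff_real.1 h.2.2.2) c
  rw [eventually_comap, eventually_atTop] at this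
  obtain ⟨R, hR⟩ := this
  exact ⟨R, fun x hx => hR _ hx x rfl⟩

lemma ph_max {E : Type*} [NormedAddCommGroup E] [NormedSpace ℝ E] [ProperSpace E]
    {φ : E → EReal} (h : IsPhi φ) {x0 : E}
    (hx0 : φ x0 ≠ ⊥) : ∃ (xm : E) (M : ℝ), φ xm = M ∧ ∀ x, φ x ≤ M := by
  obtain ⟨c, hc⟩ : ∃ c : ℝ, φ x0 = c := ⟨(φ x0).toReal, (EReal.coe_toReal (h.2.1 x0) hx0).symm⟩
  obtain ⟨R, hR⟩ := ph_coer h c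
  have hmem : x0 ∈ Metric.closedBall (0 : E) R := by
    rw [mem_closedBall_zero_iff]
    by_contra hh
    have := hR x0 (not_le.1 hh).le
    rw [hc] at this
    exact lt_irrefl _ this
  obtain ⟨xm, hxm, hmax⟩ := UpperSemicontinuousOn.exists_isMaxOn ⟨x0, hmem⟩
    (isCompact_closedBall (0 : E) R) (h.1.upperSemicontinuousOn _)
  have h0 : φ x0 ≤ φ xm := hmax hmem
  have hb : φ xm ≠ ⊥ := fun hb => hx0 (by rw [hb] at h0; exact le_bot_iff.1 h0)
  have hM : φ xm = ((φ xm).toReal : ℝ) := (EReal.coe_toReal (h.2.1 xm) hb).symm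
  refine ⟨xm, _, hM, fun x => ?_⟩
  rw [← hM]
  by_cases hx : ‖x‖ ≤ R
  · exact hmax (mem_closedBall_zero_iff.2 hx)
  · exact ((hR x (not_le.1 hx).le).le.trans hc.ge).trans h0

lemma ph_lin {E : Type*} [NormedAddCommGroup E] [NormedSpace ℝ E] [ProperSpace E]
    {φ : E → EReal} (h : IsPhi φ) :
    ∃ a b : ℝ, 0 < b ∧ ∀ x, φ x ≤ ((a - b * ‖x‖ : ℝ) : EReal) := by
  by_cases hall : ∀ x, φ x = ⊥
  · exact ⟨0, 1, one_pos, fun x => by rw [hall x]; exact bot_le⟩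
  push Not at hall
  obtain ⟨x1, hx1⟩ := hall
  obtain ⟨x0, c, hx0, hmax⟩ := ph_max h hx1
  obtain ⟨R0, hR0⟩ := ph_coer h (c - 1)
  set R := max R0 0 + ‖x0‖ + 1 with hRdef
  have hRpos : 0 < R := by positivity
  have hR : ∀ y, ‖y - x0‖ = R → φ y < ((c - 1 : ℝ) : EReal) := by
    intro y hy
    apply hR0
    have := norm_sub_le y x0
    have := le_max_left R0 0
    linarith
  refine ⟨c + 1 + ‖x0‖ / R, 1 / R, by positivity, fun x => ?_⟩
  have hn : ‖x‖ ≤ ‖x - x0‖ + ‖x0‖ := by simpa using norm_add_le (x - x0) x0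
  have key : φ x ≤ ((c + 1 - ‖x - x0‖ / R : ℝ) : EReal) := by
    set t := ‖x - x0‖ with ht
    by_cases htR : t ≤ R
    · refine (hmax x).trans ?_
      norm_cast
      have : t / R ≤ 1 := (div_le_one hRpos).2 htR
      linarith
    · push Not at htR
      have htpos : 0 < t := hRpos.trans htR
      by_contra hcon
      push Not at hcon
      have h1 : R / t < 1 := (div_lt_one htpos).2 htR
      have h2 : 0 < R / t := by positivity
      have := ph_conc h (a := 1 - R / t) (b := R / t) (by linarith) h2 (by ring)
        hx0.ge hcon.le
      have h3 := hR ((1 - R / t) • x0 + (R / t) • x) (by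
        have : (1 - R / t) • x0 + (R / t) • x - x0 = (R / t) • (x - x0) := by module
        rw [this, norm_smul, Real.norm_of_nonneg h2.le, ← ht]
        field_simp)
      have h4 := this.trans_lt h3
      norm_cast at h4
      have h5 : (R / t) * (c + 1 - t / R) = (R/t) * c + R / t - 1 := by
        field_simp
      rw [h5] at h4
      linarith
  refine key.trans ?_
  norm_cast
  have : ‖x‖ / R ≤ (‖x - x0‖ + ‖x0‖) / R := by gcongr
  rw [add_div] at this
  have e : 1 / R * ‖x‖ = ‖x‖ / R := by ring
  linarith

lemma exp_int (d : ℕ) :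
    ∫⁻ x : EuclideanSpace ℝ (Fin d), ENNReal.ofReal (Real.exp (-‖x‖)) ≠ ⊤ := by
  have hi : Integrable (fun x : EuclideanSpace ℝ (Fin d) => Real.exp (-‖x‖)) := by
    have h1 := (integrable_one_add_norm (E := EuclideanSpace ℝ (Fin d)) (μ := volume)
      (r := ((d + 1 : ℕ) : ℝ)) (by simp)).const_mul (Real.exp 1 * (Nat.factorial (d + 1) : ℝ))
    refine h1.mono' (by fun_prop) (ae_of_all _ fun x => ?_)
    have hp : 0 ≤ ‖x‖ := norm_nonneg x
    rw [Real.norm_of_nonneg (Real.exp_pos _).le, Real.rpow_neg (by linarith), Real.rpow_natCast,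
      Real.exp_neg]
    have h2 := Real.pow_div_factorial_le_exp (x := 1 + ‖x‖) (by linarith) (d + 1)
    rw [Real.exp_add, div_le_iff₀ (by positivity)] at h2
    rw [← div_eq_mul_inv, inv_le_iff_one_le_mul₀ (Real.exp_pos _), div_mul_eq_mul_div,
      le_div_iff₀ (by positivity)]
    linarith
  exact (hasFiniteIntegral_iff_ofReal (ae_of_all _ fun x => (Real.exp_pos _).le)).1 hi.2 |>.ne

lemma toENN_coe (r : ℝ) : EReal.toENN (r : EReal) = ENNReal.ofReal r := by
  simp [EReal.toENN]

lemma toENN_mono {x y : EReal} (h : x ≤ y) : x.toENN ≤ y.toENN := by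
  induction y with
  | top => simp [EReal.toENN]
  | bot => rw [le_bot_iff.1 h]
  | coe r =>
    induction x with
    | top => simp at h
    | bot => simp [EReal.toENN]
    | coe s =>
      rw [toENN_coe, toENN_coe]
      exact ENNReal.ofReal_le_ofReal (by exact_mod_cast h)

lemma eint_coe {E : Type*} [MeasurableSpace E] {Q : Measure E} {f : E → ℝ} (hf : Integrable f Q) :
    eint Q (fun x => (f x : EReal)) = ((∫ x, f x ∂Q : ℝ) : EReal) := by
  unfold eint
  rw [integral_eq_lintegral_pos_part_sub_lintegral_neg_part hf]
  have h1 : ∫⁻ x, ENNReal.ofReal (f x) ∂Q ≠ ⊤ := by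
    refine ne_top_of_le_ne_top hf.2.ne (lintegral_mono fun x => ?_)
    exact Real.ofReal_le_enorm _
  have h2 : ∫⁻ x, ENNReal.ofReal (-f x) ∂Q ≠ ⊤ := by
    refine ne_top_of_le_ne_top hf.neg.2.ne (lintegral_mono fun x => ?_)
    exact Real.ofReal_le_enorm _
  have e : ∀ x, (-(f x : EReal)).toENN = ENNReal.ofReal (-f x) := fun x => by
    rw [← EReal.coe_neg, toENN_coe]
  simp only [e, toENN_coe]
  rw [EReal.coe_sub, EReal.coe_ennreal_toReal h1, EReal.coe_ennreal_toReal h2]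

lemma isPhi_coe {E : Type*} [NormedAddCommGroup E] [NormedSpace ℝ E] {f : E → ℝ} {c : ℝ}
    (hf : Continuous f) (hc : ConcaveOn ℝ univ f) (hb : ∀ x, f x ≤ c - ‖x‖) :
    IsPhi (fun x => (f x : EReal)) := by
  refine ⟨(continuous_coe_real_ereal.comp hf).upperSemicontinuous, fun x => EReal.coe_ne_top _, ?_, ?_⟩
  · intro x y a b ha hb hab
    have := hc.2 (mem_univ x) (mem_univ y) ha.le hb.le hab
    simp only [smul_eq_mul] at this
    beta_reduce
    exact_mod_cast this
  · rw [EReal.tendsto_nhds_bot_iff_real]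
    intro r
    rw [eventually_comap, eventually_atTop]
    refine ⟨c - r + 1, fun t ht x hx => ?_⟩
    have := hb x
    norm_cast
    linarith

lemma infDist_cvx {E : Type*} [NormedAddCommGroup E] [NormedSpace ℝ E] [ProperSpace E]
    {C : Set E} (hC : Convex ℝ C) (hcl : IsClosed C) (hne : C.Nonempty) :
    ConvexOn ℝ univ (fun x => Metric.infDist x C) := by
  refine ⟨convex_univ, fun x _ y _ a b ha hb hab => ?_⟩
  obtain ⟨p, hp, hp'⟩ := hcl.exists_infDist_eq_dist hne x
  obtain ⟨q, hq, hq'⟩ := hcl.exists_infDist_eq_dist hne y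
  simp only [hp', hq', smul_eq_mul]
  refine (Metric.infDist_le_dist_of_mem (hC hp hq ha hb hab)).trans ?_
  rw [dist_eq_norm, dist_eq_norm, dist_eq_norm]
  have : a • x + b • y - (a • p + b • q) = a • (x - p) + b • (y - q) := by module
  rw [this]
  refine (norm_add_le _ _).trans ?_
  rw [norm_smul, norm_smul, Real.norm_of_nonneg ha, Real.norm_of_nonneg hb]

lemma csupp_closed {E : Type*} [NormedAddCommGroup E] [NormedSpace ℝ E] [MeasurableSpace E]
    (Q : Measure E) : IsClosed (csupp Q) := isClosed_sInter fun _ h => h.1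

lemma csupp_convex {E : Type*} [NormedAddCommGroup E] [NormedSpace ℝ E] [MeasurableSpace E]
    (Q : Measure E) : Convex ℝ (csupp Q) := convex_sInter fun _ h => h.2.1

lemma csupp_full {E : Type*} [NormedAddCommGroup E] [NormedSpace ℝ E] [MeasurableSpace E]
    [BorelSpace E] [SecondCountableTopology E] (Q : Measure E) [IsProbabilityMeasure Q] :
    ∀ᵐ x ∂Q, x ∈ csupp Q := by
  obtain ⟨T, hT, hTs, hTe⟩ := TopologicalSpace.isOpen_biUnion_countable
    {C : Set E | IsClosed C ∧ Convex ℝ C ∧ Q C = 1} compl (fun C hC => hC.1.isOpen_compl)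
  have hz : Q (⋃ C ∈ T, Cᶜ) = 0 := by
    rw [measure_biUnion_null_iff hTs]
    intro C hC
    rw [prob_compl_eq_zero_iff (hT hC).1.measurableSet]
    exact (hT hC).2.2
  rw [hTe] at hz
  rw [ae_iff]
  convert hz using 2
  ext x
  simp only [csupp, Set.mem_ofPred_eq, mem_sInter, mem_iUnion, mem_compl_iff]
  push Not
  simp [and_assoc]

lemma Lfun_coe {E : Type*} [NormedAddCommGroup E] [NormedSpace ℝ E] [MeasureSpace E]
    {Q : Measure E} {f : E → ℝ} (hf : Integrable f Q)
    (hI : ∫⁻ x, ENNReal.ofReal (Real.exp (f x)) ≠ ⊤) :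
    Lfun (fun x => (f x : EReal)) Q =
      ((∫ x, f x ∂Q - (∫⁻ x, ENNReal.ofReal (Real.exp (f x))).toReal + 1 : ℝ) : EReal) := by
  unfold Lfun
  rw [eint_coe hf]
  simp only [EReal.exp_coe]
  rw [EReal.coe_add, EReal.coe_sub, EReal.coe_ennreal_toReal hI]
  rfl

lemma le_Lprof {E : Type*} [NormedAddCommGroup E] [NormedSpace ℝ E] [MeasureSpace E]
    {Q : Measure E} {φ : E → EReal} (h : IsPhi φ) : Lfun φ Q ≤ Lprof Q :=
  le_iSup₂_of_le φ h le_rfl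

lemma norm_concave {E : Type*} [NormedAddCommGroup E] [NormedSpace ℝ E] (c : ℝ) :
    ConcaveOn ℝ univ (fun x : E => c - ‖x‖) :=
  (concaveOn_const c convex_univ).sub convexOn_univ_norm

lemma norm_integrable {d : ℕ} {Q : Measure (EuclideanSpace ℝ (Fin d))} 
    (h : (∫⁻ x, (‖x‖₊ : ℝ≥0∞) ∂Q) ≠ ⊤) : Integrable (fun x => ‖x‖) Q := by
  refine (integrable_norm_iff (f := fun x => x) (by fun_prop)).2 ⟨by fun_prop, ?_⟩
  exact lt_top_iff_ne_top.2 h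

lemma exp_int' (d : ℕ) (c : ℝ) :
    ∫⁻ x : EuclideanSpace ℝ (Fin d), ENNReal.ofReal (Real.exp (c - ‖x‖)) ≠ ⊤ := by
  have : ∀ x : EuclideanSpace ℝ (Fin d), ENNReal.ofReal (Real.exp (c - ‖x‖)) =
      ENNReal.ofReal (Real.exp c) * ENNReal.ofReal (Real.exp (-‖x‖)) := fun x => by
    rw [← ENNReal.ofReal_mul (Real.exp_pos _).le, ← Real.exp_add, sub_eq_add_neg]
  simp only [this]
  rw [lintegral_const_mul' _ _ ENNReal.ofReal_ne_top]
  exact ENNReal.mul_ne_top ENNReal.ofReal_ne_top (exp_int d)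

lemma Lprof_ne_bot {d : ℕ} {Q : Measure (EuclideanSpace ℝ (Fin d))} [IsProbabilityMeasure Q]
    (h : (∫⁻ x, (‖x‖₊ : ℝ≥0∞) ∂Q) ≠ ⊤) : Lprof Q ≠ ⊥ := by
  intro hb
  have h1 := le_Lprof (Q := Q) (isPhi_coe (f := fun x => 0 - ‖x‖) (c := 0) (by fun_prop)
    (norm_concave 0) (fun x => le_rfl))
  have hint : Integrable (fun x => 0 - ‖x‖) Q := (integrable_const 0).sub (norm_integrable h)
  rw [Lfun_coe hint (exp_int' d 0), hb] at h1
  exact EReal.coe_ne_bot _ (le_bot_iff.1 h1)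

lemma Lprof_top {d : ℕ} {Q : Measure (EuclideanSpace ℝ (Fin d))} [IsProbabilityMeasure Q]
    (h : (∫⁻ x, (‖x‖₊ : ℝ≥0∞) ∂Q) ≠ ⊤) (hi : ¬ (interior (csupp Q)).Nonempty) :
    Lprof Q = ⊤ := by
  have hn := norm_integrable h
  have hcl := csupp_closed Q
  have hcv := csupp_convex Q
  have hful := csupp_full Q
  have hne : (csupp Q).Nonempty := hful.exists
  have hnull : volume (csupp Q) = 0 := by
    have := hcv.addHaar_frontier volume
    rwa [hcl.frontier_eq, not_nonempty_iff_eq_empty.1 hi, Set.sdiff_empty] at this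
  rw [EReal.eq_top_iff_forall_lt]
  intro y
  set c : ℝ := y + ∫ x, ‖x‖ ∂Q + 1 with hcdef
  let f : ℕ → EuclideanSpace ℝ (Fin d) → ℝ :=
    fun k x => (c - ‖x‖) - k * Metric.infDist x (csupp Q)
  have hle : ∀ k x, f k x ≤ c - ‖x‖ := fun k x => by
    have : 0 ≤ (k : ℝ) * Metric.infDist x (csupp Q) := 
      mul_nonneg (Nat.cast_nonneg _) Metric.infDist_nonneg
    simp only [f]; linarith
  have hcont : ∀ k, Continuous (f k) := fun k => by
    have := Metric.continuous_infDist_pt (csupp Q)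
    simp only [f]; fun_prop
  have hlim := tendsto_lintegral_of_dominated_convergence (μ := volume)
    (F := fun k x => ENNReal.ofReal (Real.exp (f k x))) (f := fun _ => 0)
    (fun x => ENNReal.ofReal (Real.exp (c - ‖x‖)))
    (fun k => by have := (hcont k).measurable; fun_prop)
    (fun k => ae_of_all _ fun x => ENNReal.ofReal_le_ofReal (Real.exp_le_exp.2 (hle k x)))
    (exp_int' d c) (by
      have : ∀ᵐ x ∂(volume : Measure (EuclideanSpace ℝ (Fin d))), x ∉ csupp Q :=
        measure_eq_zero_iff_ae_notMem.1 hnull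
      filter_upwards [this] with x hx
      have hpos : 0 < Metric.infDist x (csupp Q) := (hcl.notMem_iff_infDist_pos hne).1 hx
      rw [← ENNReal.ofReal_zero]
      refine ENNReal.tendsto_ofReal (Real.tendsto_exp_atBot.comp ?_)
      have h1 : Tendsto (fun k : ℕ => (k : ℝ) * Metric.infDist x (csupp Q)) atTop atTop :=
        tendsto_natCast_atTop_atTop.atTop_mul_const hpos
      simp only [f, sub_eq_add_neg]
      exact tendsto_atBot_add_const_left _ _ (tendsto_neg_atTop_atBot.comp h1))
  rw [lintegral_zero] at hlim
  obtain ⟨k, hk⟩ := (hlim.eventually (gt_mem_nhds (zero_lt_one))).exists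
  have hphi : IsPhi (fun x => (f k x : EReal)) := by
    refine isPhi_coe (hcont k) ((norm_concave c).sub ?_) (hle k)
    exact (infDist_cvx hcv hcl hne).smul (Nat.cast_nonneg k)
  have hae : f k =ᵐ[Q] fun x => c - ‖x‖ := by
    filter_upwards [hful] with x hx
    simp [f, Metric.infDist_zero_of_mem hx]
  have hint : Integrable (f k) Q := ((integrable_const c).sub hn).congr hae.symm
  refine lt_of_lt_of_le ?_ (le_Lprof hphi)
  rw [Lfun_coe hint (hk.trans ENNReal.one_lt_top).ne, integral_congr_ae hae,
    integral_sub (integrable_const c) hn]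
  have : (∫⁻ x, ENNReal.ofReal (Real.exp (f k x))).toReal ≤ 1 := by
    have := ENNReal.toReal_mono ENNReal.one_ne_top hk.le
    simpa using this
  simp only [integral_const, probReal_univ, one_smul]
  norm_cast
  linarith

lemma Lprof_bot {d : ℕ} {Q : Measure (EuclideanSpace ℝ (Fin d))} [IsProbabilityMeasure Q]
    (h : (∫⁻ x, (‖x‖₊ : ℝ≥0∞) ∂Q) = ⊤) : Lprof Q = ⊥ := by
  unfold Lprof
  simp only [iSup_eq_bot]
  intro φ hφ
  obtain ⟨a, b, hb, hab⟩ := ph_lin hφ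
  have hneg : ∫⁻ x, (-(φ x)).toENN ∂Q = ⊤ := by
    by_contra hne
    have h1 : ENNReal.ofReal b * ∫⁻ x, (‖x‖₊ : ℝ≥0∞) ∂Q ≤
        ∫⁻ x, (-(φ x)).toENN ∂Q + ENNReal.ofReal a := by
      rw [← lintegral_const_mul' _ _ ENNReal.ofReal_ne_top]
      calc _ ≤ ∫⁻ x, ((-(φ x)).toENN + ENNReal.ofReal a) ∂Q := by
            refine lintegral_mono fun x => ?_
            have h2 := toENN_mono (EReal.neg_le_neg_iff.2 (hab x))
            rw [← EReal.coe_neg, toENN_coe] at h2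
            refine le_trans ?_ (add_le_add_left h2 _)
            refine le_trans ?_ (ENNReal.ofReal_add_le)
            rw [← enorm_eq_nnnorm, ← ofReal_norm, ← ENNReal.ofReal_mul hb.le]
            exact ENNReal.ofReal_le_ofReal (by linarith)
        _ = _ := by rw [lintegral_add_right _ measurable_const]; simp
    rw [h, ENNReal.mul_top (by simpa using hb)] at h1
    exact (ENNReal.add_ne_top.2 ⟨hne, ENNReal.ofReal_ne_top⟩) (top_le_iff.1 h1)
  unfold Lfun eint
  rw [hneg, EReal.coe_ennreal_top, EReal.sub_top, EReal.bot_sub, EReal.bot_add]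

lemma halfspace_mass_pos {d : ℕ} {Q : Measure (EuclideanSpace ℝ (Fin d))} [IsProbabilityMeasure Q]
    {z : EuclideanSpace ℝ (Fin d)} {ρ : ℝ} (hρ : 0 < ρ)
    (hz : Metric.closedBall z (2 * ρ) ⊆ csupp Q) :
    ∃ δ : ℝ, 0 < δ ∧ δ ≤ 1 ∧ ∀ u : EuclideanSpace ℝ (Fin d), ‖u‖ = 1 →
      δ ≤ Q.real {x | ρ < ⟪u, x - z⟫} := by
  let F : EuclideanSpace ℝ (Fin d) → EuclideanSpace ℝ (Fin d) → ℝ :=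
    fun u x => min 1 (max 0 (⟪u, x - z⟫ - ρ))
  have hF0 : ∀ u x, 0 ≤ F u x := fun u x => le_min zero_le_one (le_max_left _ _)
  have hF1 : ∀ u x, F u x ≤ 1 := fun u x => min_le_left _ _
  have hFc : ∀ u, Continuous (F u) := fun u => by simp only [F]; fun_prop
  have hFi : ∀ u, Integrable (F u) Q := fun u =>
    (integrable_const (1 : ℝ)).mono' (hFc u).aestronglyMeasurable
      (ae_of_all _ fun x => by rw [Real.norm_of_nonneg (hF0 u x)]; exact hF1 u x)
  have hgc : Continuous fun u => ∫ x, F u x ∂Q := by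
    refine continuous_of_dominated (bound := fun _ => 1) (fun u => (hFc u).aestronglyMeasurable)
      (fun u => ae_of_all _ fun x => by rw [Real.norm_of_nonneg (hF0 u x)]; exact hF1 u x)
      (integrable_const _) (ae_of_all _ fun x => by simp only [F]; fun_prop)
  have hms : ∀ u : EuclideanSpace ℝ (Fin d), MeasurableSet {x | ρ < ⟪u, x - z⟫} := fun u =>
    (isOpen_lt continuous_const (by fun_prop)).measurableSet
  have hgle : ∀ u, ∫ x, F u x ∂Q ≤ Q.real {x | ρ < ⟪u, x - z⟫} := fun u => by
    rw [← integral_indicator_one (hms u)]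
    refine integral_mono (hFi u) ((integrable_const (1 : ℝ)).indicator (hms u)) fun x => ?_
    by_cases hx : ρ < ⟪u, x - z⟫
    · rw [Set.indicator_of_mem (by exact hx)]; exact hF1 u x
    · rw [Set.indicator_of_notMem (by exact hx)]
      simp only [F]
      rw [max_eq_left (by linarith [not_lt.1 hx])]
      simp
  have hgpos : ∀ u : EuclideanSpace ℝ (Fin d), ‖u‖ = 1 → 0 < ∫ x, F u x ∂Q := fun u hu => by
    refine lt_of_le_of_ne (integral_nonneg (hF0 u)) fun h0 => ?_
    have h1 := (integral_eq_zero_iff_of_nonneg (hF0 u) (hFi u)).1 h0.symm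
    let H : Set (EuclideanSpace ℝ (Fin d)) := {x | ⟪u, x⟫ ≤ ρ + ⟪u, z⟫}
    have hHc : IsClosed H := isClosed_le (by fun_prop) continuous_const
    have hHv : Convex ℝ H := convex_halfSpace_le (f := fun x => ⟪u, x⟫)
      ⟨fun x y => inner_add_right _ _ _, fun c x => inner_smul_right _ _ _⟩ _
    have hHq : Q H = 1 := by
      rw [← prob_compl_eq_zero_iff hHc.measurableSet, ← mem_ae_iff]
      filter_upwards [h1] with x hx
      by_contra hc
      simp only [H, Set.mem_ofPred_eq, not_le] at hc
      have hlt : 0 < ⟪u, x - z⟫ - ρ := by rw [inner_sub_right]; linarith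
      have : 0 < F u x := lt_min one_pos (lt_max_of_lt_right hlt)
      rw [hx] at this
      exact lt_irrefl _ this
    have hmem : z + (2 * ρ) • u ∈ csupp Q := hz (by
      rw [mem_closedBall_iff_norm, add_sub_cancel_left, norm_smul, hu,
        Real.norm_of_nonneg (by linarith), mul_one])
    have := Set.mem_sInter.1 hmem H ⟨hHc, hHv, hHq⟩
    simp only [H, Set.mem_ofPred_eq, inner_add_right, inner_smul_right, real_inner_self_eq_norm_sq,
      hu] at this
    linarith
  rcases (Metric.sphere (0 : EuclideanSpace ℝ (Fin d)) 1).eq_empty_or_nonempty with he | hne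
  · refine ⟨1, one_pos, le_rfl, fun u hu => ?_⟩
    have : u ∈ Metric.sphere (0 : EuclideanSpace ℝ (Fin d)) 1 := by simpa using hu
    rw [he] at this
    exact this.elim
  · obtain ⟨u0, hu0, hmin⟩ := (isCompact_sphere (0 : EuclideanSpace ℝ (Fin d)) 1).exists_isMinOn hne
      hgc.continuousOn
    refine ⟨∫ x, F u0 x ∂Q, hgpos u0 (by simpa using hu0), (hgle u0).trans measureReal_le_one,
      fun u hu => le_trans ?_ (hgle u)⟩
    exact hmin (by simpa using hu)

lemma key_ball {d : ℕ} {Q : Measure (EuclideanSpace ℝ (Fin d))} [IsProbabilityMeasure Q]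
    (hi : (interior (csupp Q)).Nonempty) :
    ∃ (z : EuclideanSpace ℝ (Fin d)) (ρ δ : ℝ), 0 < ρ ∧ 0 < δ ∧ δ ≤ 1 ∧
      ∀ C : Set (EuclideanSpace ℝ (Fin d)), IsClosed C → Convex ℝ C → 1 - δ < Q.real C →
        Metric.ball z ρ ⊆ C := by
  obtain ⟨z, hz⟩ := hi
  obtain ⟨ε, hε, hεs⟩ := Metric.nhds_basis_closedBall.mem_iff.1 (mem_interior_iff_mem_nhds.1 hz)
  obtain ⟨δ, hδ, hδ1, hu⟩ := halfspace_mass_pos (Q := Q) (z := z) (ρ := ε / 2) (by linarith)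
    (by rwa [mul_div_cancel₀ _ two_ne_zero])
  refine ⟨z, ε / 2, δ, by linarith, hδ, hδ1, fun C hcl hcv hQ y hy => ?_⟩
  by_contra hyC
  obtain ⟨f, s, hfs, hsy⟩ := geometric_hahn_banach_closed_point hcv hcl hyC
  have hne : C.Nonempty := by
    rw [Set.nonempty_iff_ne_empty]
    rintro rfl
    simp at hQ
    linarith
  let v := (InnerProductSpace.toDual ℝ (EuclideanSpace ℝ (Fin d))).symm f
  have hv : ∀ x, f x = ⟪v, x⟫ := fun x => (InnerProductSpace.toDual_symm_apply).symm
  have hv0 : 0 < ‖v‖ := by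
    rw [norm_pos_iff]
    intro h0
    obtain ⟨x, hx⟩ := hne
    have := hfs x hx
    rw [hv, h0] at this hsy
    simp at this hsy
    linarith
  have hvn : ‖(‖v‖⁻¹ • v)‖ = 1 := by
    rw [norm_smul, norm_inv, norm_norm, inv_mul_cancel₀ hv0.ne']
  have h1 := hu (‖v‖⁻¹ • v) hvn
  have hdisj : Disjoint C {x | ε / 2 < ⟪‖v‖⁻¹ • v, x - z⟫} := by
    rw [Set.disjoint_left]
    intro x hx hx2
    simp only [Set.mem_ofPred_eq, inner_sub_right] at hx2
    have h2 : ⟪‖v‖⁻¹ • v, x⟫ ≤ ⟪‖v‖⁻¹ • v, y⟫ := by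
      rw [real_inner_smul_left, real_inner_smul_left, ← hv, ← hv]
      have := (hfs x hx).trans hsy
      gcongr
    have h3 := real_inner_le_norm (‖v‖⁻¹ • v) (y - z)
    rw [hvn, inner_sub_right] at h3
    rw [mem_ball_iff_norm] at hy
    linarith
  have hms : MeasurableSet {x | ε / 2 < ⟪‖v‖⁻¹ • v, x - z⟫} :=
    (isOpen_lt continuous_const (by fun_prop)).measurableSet
  have h4 := measureReal_union (μ := Q) hdisj hms
  have h5 : Q.real (C ∪ {x | ε / 2 < ⟪‖v‖⁻¹ • v, x - z⟫}) ≤ 1 := measureReal_le_one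
  linarith

lemma Lfun_le_of {d : ℕ} {Q : Measure (EuclideanSpace ℝ (Fin d))} 
    {φ : EuclideanSpace ℝ (Fin d) → EReal} {p n e : ℝ} (hp0 : 0 ≤ p) (hn0 : 0 ≤ n) (he0 : 0 ≤ e)
    (hp : ∫⁻ x, (φ x).toENN ∂Q ≤ ENNReal.ofReal p) (hn : ENNReal.ofReal n ≤ ∫⁻ x, (-φ x).toENN ∂Q)
    (he : ENNReal.ofReal e ≤ ∫⁻ x, EReal.exp (φ x)) :
    Lfun φ Q ≤ ((p - n - e + 1 : ℝ) : EReal) := by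
  have c : ∀ r : ℝ, 0 ≤ r → ((ENNReal.ofReal r : ℝ≥0∞) : EReal) = (r : EReal) := fun r hr => by
    rw [EReal.coe_ennreal_ofReal, max_eq_left hr]
  unfold Lfun eint
  rw [EReal.coe_add, EReal.coe_sub, EReal.coe_sub, ← c p hp0, ← c n hn0, ← c e he0]
  refine add_le_add ?_ le_rfl
  refine EReal.sub_le_sub (EReal.sub_le_sub ?_ ?_) ?_ <;>
    exact EReal.coe_ennreal_le_coe_ennreal_iff.2 (by assumption)

lemma Lprof_ne_top {d : ℕ} {Q : Measure (EuclideanSpace ℝ (Fin d))} [IsProbabilityMeasure Q]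
    (hi : (interior (csupp Q)).Nonempty) : Lprof Q ≠ ⊤ := by
  obtain ⟨z, ρ, δ, hρ, hδ, hδ1, hball⟩ := key_ball hi
  set κ := 1 / δ with hκ
  have hκ0 : 0 < κ := by positivity
  set l := 1 / (2 * (1 + κ)) with hl
  have hl0 : 0 < l := by positivity
  have hl1 : l < 1 := by rw [hl, div_lt_one (by positivity)]; linarith
  set η := (volume : Measure (EuclideanSpace ℝ (Fin d))).real (Metric.ball 0 (l * ρ)) with hη
  have hη0 : 0 < η :=
    ENNReal.toReal_pos (Metric.measure_ball_pos _ _ (by positivity)).ne' measure_ball_lt_top.ne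
  have hbound : Lprof Q ≤ ((2 / η + 1 : ℝ) : EReal) := by
    refine iSup₂_le fun φ hφ => ?_
    have hφ : IsPhi φ := hφ
    by_cases hall : ∀ x, φ x = ⊥
    · have : ∫⁻ x, (-φ x).toENN ∂Q = ⊤ := by simp [hall, EReal.toENN]
      unfold Lfun eint
      rw [this, EReal.coe_ennreal_top, EReal.sub_top, EReal.bot_sub, EReal.bot_add]
      exact bot_le
    push Not at hall
    obtain ⟨x1, hx1⟩ := hall
    obtain ⟨xm, M, hxm, hmax⟩ := ph_max hφ hx1
    by_cases hM : M ≤ 0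
    · have hz : ∀ x, (φ x).toENN = 0 := fun x => by
        have := toENN_mono (hmax x)
        rw [toENN_coe, ENNReal.ofReal_of_nonpos hM] at this
        exact le_antisymm this zero_le
      refine (Lfun_le_of (p := 0) (n := 0) (e := 0) le_rfl le_rfl le_rfl (by simp [hz])
        (by simp) (by simp)).trans ?_
      rw [EReal.coe_le_coe_iff]
      have : 0 < 2 / η := by positivity
      linarith
    push Not at hM
    set D := {x | ((-(κ * M) : ℝ) : EReal) ≤ φ x} with hD
    have hDc : IsClosed D := ph_closed hφ _
    have hDv : Convex ℝ D := ph_convex hφ _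
    set q := Q.real D with hq
    have hq0 : 0 ≤ q := measureReal_nonneg
    have hq1 : q ≤ 1 := measureReal_le_one
    have hQD : Q D = ENNReal.ofReal q := (ENNReal.ofReal_toReal (measure_ne_top _ _)).symm
    have hQDc : Q Dᶜ = ENNReal.ofReal (1 - q) := by
      rw [hq, ← probReal_compl_eq_one_sub hDc.measurableSet]
      exact (ENNReal.ofReal_toReal (measure_ne_top _ _)).symm
    have hp : ∫⁻ x, (φ x).toENN ∂Q ≤ ENNReal.ofReal (M * q) := by
      rw [ENNReal.ofReal_mul hM.le, ← hQD, ← lintegral_indicator_const hDc.measurableSet]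
      refine lintegral_mono fun x => ?_
      by_cases hx : x ∈ D
      · rw [Set.indicator_of_mem hx, ← toENN_coe]
        exact toENN_mono (hmax x)
      · rw [Set.indicator_of_notMem hx]
        have h1 : φ x ≤ ((-(κ * M) : ℝ) : EReal) := (not_le.1 hx).le
        have h2 := toENN_mono h1
        rwa [toENN_coe, ENNReal.ofReal_of_nonpos (by have := mul_pos hκ0 hM; linarith)] at h2
    have hn : ENNReal.ofReal (κ * M * (1 - q)) ≤ ∫⁻ x, (-φ x).toENN ∂Q := by
      rw [ENNReal.ofReal_mul (by positivity), ← hQDc,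
        ← lintegral_indicator_const hDc.measurableSet.compl]
      refine lintegral_mono fun x => ?_
      by_cases hx : x ∈ Dᶜ
      · rw [Set.indicator_of_mem hx]
        have hx' : x ∉ D := hx
        have h1 : φ x ≤ ((-(κ * M) : ℝ) : EReal) := (not_le.1 hx').le
        have h2 := toENN_mono (EReal.neg_le_neg_iff.2 h1)
        rwa [← EReal.coe_neg, neg_neg, toENN_coe] at h2
      · rw [Set.indicator_of_notMem hx]
        exact zero_le
    by_cases hqd : 1 - δ < q
    · have hB := hball D hDc hDv hqd
      have hsub : Metric.ball ((1 - l) • xm + l • z) (l * ρ) ⊆ {x | ((M / 2 : ℝ) : EReal) ≤ φ x} := by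
        intro y hy
        let w := z + l⁻¹ • (y - ((1 - l) • xm + l • z))
        have hw : w ∈ Metric.ball z ρ := by
          rw [mem_ball_iff_norm] at hy ⊢
          simp only [w, add_sub_cancel_left]
          rw [norm_smul, norm_inv, Real.norm_of_nonneg hl0.le, inv_mul_lt_iff₀ hl0]
          exact hy
        have h1 := ph_conc hφ (a := 1 - l) (b := l) (by linarith) hl0 (by ring) hxm.ge (hB hw)
        have e1 : (1 - l) • xm + l • w = y := by
          simp only [w]
          rw [smul_add, smul_smul, mul_inv_cancel₀ hl0.ne']
          module
        have e2 : (1 - l) * M + l * (-(κ * M)) = M / 2 := by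
          rw [hl]; field_simp; ring
        rw [e1, e2] at h1
        exact h1
      have he : ENNReal.ofReal (Real.exp (M / 2) * η) ≤ ∫⁻ x, EReal.exp (φ x) := by
        have hv : volume (Metric.ball ((1 - l) • xm + l • z) (l * ρ)) = ENNReal.ofReal η := by
          rw [Measure.addHaar_ball_center]
          exact (ENNReal.ofReal_toReal measure_ball_lt_top.ne).symm
        rw [ENNReal.ofReal_mul (Real.exp_pos _).le, ← hv,
          ← lintegral_indicator_const measurableSet_ball]
        refine lintegral_mono fun x => ?_
        by_cases hx : x ∈ Metric.ball ((1 - l) • xm + l • z) (l * ρ)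
        · rw [Set.indicator_of_mem hx, ← EReal.exp_coe]
          exact EReal.exp_monotone (hsub hx)
        · rw [Set.indicator_of_notMem hx]
          exact zero_le
      refine (Lfun_le_of (by positivity) (mul_nonneg (by positivity) (by linarith))
        (by positivity) hp hn he).trans ?_
      norm_cast
      have h1 : M * q ≤ M := mul_le_of_le_one_right hM.le hq1
      have h2 : 0 ≤ κ * M * (1 - q) := mul_nonneg (by positivity) (by linarith)
      have h3 : (M / 2) ^ 2 / 2 ≤ Real.exp (M / 2) := by
        simpa using Real.pow_div_factorial_le_exp (x := M / 2) (by linarith) 2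
      have h4 : (M / 2) ^ 2 / 2 * η ≤ Real.exp (M / 2) * η := by gcongr
      have h5 : M - (M / 2) ^ 2 / 2 * η ≤ 2 / η := by
        rw [le_div_iff₀ hη0]
        nlinarith [sq_nonneg (M * η - 4)]
      linarith
    · refine (Lfun_le_of (e := 0) (by positivity) (mul_nonneg (by positivity) (by linarith))
        le_rfl hp hn (by simp)).trans ?_
      norm_cast
      push Not at hqd
      have h1 : M * q ≤ M := mul_le_of_le_one_right hM.le hq1
      have h2 : M ≤ κ * M * (1 - q) := by
        have : κ * M * δ = M := by rw [hκ]; field_simp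
        calc M = κ * M * δ := this.symm
          _ ≤ _ := by gcongr; linarith
      have : 0 < 2 / η := by positivity
      linarith
  exact (hbound.trans_lt (EReal.coe_lt_top _)).ne

/-- **Theorem 1 (finiteness part).** `L(Q)` is real iff `∫‖x‖ dQ < ∞` and `csupp Q` has
nonempty interior; moreover `L(Q) = -∞` if `∫‖x‖ dQ = ∞`, and `L(Q) = +∞` if
`∫‖x‖ dQ < ∞` but the interior of `csupp Q` is empty. -/
theorem Lprof_real_iff {d : ℕ}
    (Q : Measure (EuclideanSpace ℝ (Fin d))) [IsProbabilityMeasure Q] :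
    ((Lprof Q ≠ ⊥ ∧ Lprof Q ≠ ⊤) ↔
      ((∫⁻ x, (‖x‖₊ : ℝ≥0∞) ∂Q) ≠ ⊤ ∧ (interior (csupp Q)).Nonempty)) ∧
    ((∫⁻ x, (‖x‖₊ : ℝ≥0∞) ∂Q) = ⊤ → Lprof Q = ⊥) ∧
    ((∫⁻ x, (‖x‖₊ : ℝ≥0∞) ∂Q) ≠ ⊤ → ¬(interior (csupp Q)).Nonempty → Lprof Q = ⊤) := by
  refine ⟨⟨fun ⟨h1, h2⟩ => ?_, fun ⟨h1, h2⟩ => ⟨Lprof_ne_bot h1, Lprof_ne_top h2⟩⟩,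
    Lprof_bot, Lprof_top⟩
  have h3 : (∫⁻ x, (‖x‖₊ : ℝ≥0∞) ∂Q) ≠ ⊤ := fun h => h1 (Lprof_bot h)
  exact ⟨h3, by_contra fun h => h2 (Lprof_top h3 h)⟩
end
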